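/- arXiv:1908.08349 — 2 statements merged into one kernel-verified Lean document; each statement's English description precedes it below -/
import Mathlib

section
/- Let (Q,≼_Q) be a totally ordered set with |Q| > 1 having a smallest element q₀. Then the following three conditions are equivalent: (i) the order topology on Q (the ≼_Q-topology) is second countable; (ii) for every ≼_Q-pseudoultrametric d (on any nonempty set X) there is a real-valued pseudoultrametric ρ such that d and ρ are weakly similar; (iii) for every ≼_Q-pseudoultrametric d there is a real-valued pseudoultrametric ρ such that d and ρ are combinatorially similar. -/
namespace CombSimPaper

/-- The range `Φ(X²)` of a mapping `Φ` with domain `X²`. -/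
def rng {X A : Type*} (Φ : X → X → A) : Set A := {a | ∃ x y, Φ x y = a}

/-- `Φ` is strongly consistent with the binary relation `R` on `X`. -/
def StronglyConsistent {X A : Type*} (Φ : X → X → A) (R : X → X → Prop) : Prop :=
  ∀ x₁ x₂ x₃ x₄, R x₁ x₂ → R x₃ x₄ → Φ x₁ x₃ = Φ x₂ x₄

/-- The fiber `Φ⁻¹(a)`, viewed as a binary relation on `X`. -/
def fiber {X A : Type*} (Φ : X → X → A) (a : A) : X → X → Prop :=
  fun x y => Φ x y = a

/-- `Φ` is `a₀`-coherent: the fiber `Φ⁻¹(a₀)` is an equivalence relation and `Φ` is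
strongly consistent with it. -/
def Coherent {X A : Type*} (Φ : X → X → A) (a₀ : A) : Prop :=
  Equivalence (fiber Φ a₀) ∧ StronglyConsistent Φ (fiber Φ a₀)

/-- `g : Y → X` is a combinatorial similarity for the mappings `Ψ` (with domain `Y²`)
and `Φ` (with domain `X²`). -/
def CombSimWith {X Y A B : Type*} (Φ : X → X → A) (Ψ : Y → Y → B) (g : Y → X) : Prop :=
  Function.Bijective g ∧ ∃ f : A → B, Set.BijOn f (rng Φ) (rng Ψ) ∧
    ∀ x y : Y, Ψ x y = f (Φ (g x) (g y))

/-- `Φ` is combinatorially similar to `Ψ`. -/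
def CombSim {X Y A B : Type*} (Φ : X → X → A) (Ψ : Y → Y → B) : Prop :=
  ∃ g : Y → X, CombSimWith Φ Ψ g

/-- Some permutation `⟨x_{i₁}, x_{i₂}, x_{i₃}⟩` of the triple `⟨x₁, x₂, x₃⟩`
satisfies the ternary predicate `P`. -/
def PermTriple {X : Type*} (P : X → X → X → Prop) (x₁ x₂ x₃ : X) : Prop :=
  ∃ σ : Equiv.Perm (Fin 3),
    P (![x₁, x₂, x₃] (σ 0)) (![x₁, x₂, x₃] (σ 1)) (![x₁, x₂, x₃] (σ 2))

/-- `d : X² → Q` is a `≼`-pseudoultrametric (for the order `le` with smallest element `q₀`). -/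
def QPseudoUltra {X Q : Type*} (le : Q → Q → Prop) (q₀ : Q) (d : X → X → Q) : Prop :=
  (∀ x y, d x y = d y x) ∧ (∀ x, d x x = q₀) ∧
  ∀ x₁ x₂ x₃, PermTriple (fun a b c => le (d a c) (d a b) ∧ d a b = d b c) x₁ x₂ x₃

/-- `d : X² → Q` is a `≼`-ultrametric. -/
def QUltra {X Q : Type*} (le : Q → Q → Prop) (q₀ : Q) (d : X → X → Q) : Prop :=
  QPseudoUltra le q₀ d ∧ ∀ x y, d x y = q₀ ↔ x = y

/-- The binary relation `u_Φ` on the range of `Φ`. -/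
def uRel {X A : Type*} (Φ : X → X → A) : A → A → Prop :=
  fun y₁ y₂ => ∃ x₁ x₂ x₃, y₁ = Φ x₁ x₃ ∧ y₂ = Φ x₁ x₂ ∧ Φ x₁ x₂ = Φ x₂ x₃

/-- The binary relation `≼_Φ := u_Φᵗ ∪ Δ_{Φ(X²)}`. -/
def lePhi {X A : Type*} (Φ : X → X → A) : A → A → Prop :=
  fun a b => Relation.TransGen (uRel Φ) a b ∨ (a = b ∧ a ∈ rng Φ)

/-- `r` is a partial order on the subset `S`. -/
def IsPartialOrderOn {A : Type*} (S : Set A) (r : A → A → Prop) : Prop :=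
  (∀ a ∈ S, r a a) ∧
  (∀ a b c, a ∈ S → b ∈ S → c ∈ S → r a b → r b c → r a c) ∧
  (∀ a b, a ∈ S → b ∈ S → r a b → r b a → a = b)

/-- `r` is a linear (total) order on the subset `S`. -/
def IsLinearOrderOn {A : Type*} (S : Set A) (r : A → A → Prop) : Prop :=
  IsPartialOrderOn S r ∧ ∀ a b, a ∈ S → b ∈ S → (r a b ∨ r b a)

/-- A (real-valued, nonnegative) pseudometric. -/
def IsPseudoMetric {X : Type*} (d : X → X → ℝ) : Prop :=
  (∀ x y, 0 ≤ d x y) ∧ (∀ x y, d x y = d y x) ∧ (∀ x, d x x = 0) ∧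
  ∀ x y z, d x y ≤ d x z + d z y

/-- A (real-valued) metric. -/
def IsMetric {X : Type*} (d : X → X → ℝ) : Prop :=
  IsPseudoMetric d ∧ ∀ x y, d x y = 0 ↔ x = y

/-- A (real-valued, nonnegative) pseudoultrametric. -/
def IsPseudoUltrametric {X : Type*} (d : X → X → ℝ) : Prop :=
  (∀ x y, 0 ≤ d x y) ∧ (∀ x y, d x y = d y x) ∧ (∀ x, d x x = 0) ∧
  ∀ x y z, d x y ≤ max (d x z) (d z y)

/-- A (real-valued) ultrametric. -/
def IsUltrametric {X : Type*} (d : X → X → ℝ) : Prop :=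
  IsPseudoUltrametric d ∧ ∀ x y, d x y = 0 ↔ x = y

/-- `d` is a `le`-pseudoultrametric, where `le` is a partial order on `Q` having a smallest
element. -/
def IsPseudoUltraFor {X Q : Type*} (d : X → X → Q) (le : Q → Q → Prop) : Prop :=
  IsPartialOrder Q le ∧ ∃ q₀, (∀ q, le q₀ q) ∧ QPseudoUltra le q₀ d

/-- `g : X₁ → X₂` is a weak similarity for the `Q₁`-pseudoultrametric `d₁` and the
`Q₂`-pseudoultrametric `d₂`: `g` is a bijection and there is an order isomorphism
`f` of the subposet `d₂(X₂²)` of `Q₂` onto the subposet `d₁(X₁²)` of `Q₁` with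
`d₁(x, y) = f (d₂ (g x) (g y))`. -/
def WeakSim {X₁ X₂ Q₁ Q₂ : Type*} (le₁ : Q₁ → Q₁ → Prop) (le₂ : Q₂ → Q₂ → Prop)
    (d₁ : X₁ → X₁ → Q₁) (d₂ : X₂ → X₂ → Q₂) (g : X₁ → X₂) : Prop :=
  Function.Bijective g ∧ ∃ f : Q₂ → Q₁,
    Set.BijOn f (rng d₂) (rng d₁) ∧
    (∀ a ∈ rng d₂, ∀ b ∈ rng d₂, (le₂ a b ↔ le₁ (f a) (f b))) ∧
    ∀ x y, d₁ x y = f (d₂ (g x) (g y))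

/-- The subset `S`, ordered by `r`, is order-isomorphic to a subposet of `(ℝ⁺, ≤)`. -/
def EmbedsInRPlus {A : Type*} (S : Set A) (r : A → A → Prop) : Prop :=
  ∃ e : A → ℝ, (∀ a ∈ S, 0 ≤ e a) ∧ Set.InjOn e S ∧
    ∀ a ∈ S, ∀ b ∈ S, (r a b ↔ e a ≤ e b)

open Set in
/-- A linear order whose order topology is second countable embeds into the real line. -/
lemma exists_strictMono_real (α : Type*) [LinearOrder α] [TopologicalSpace α] [OrderTopology α]
    [SecondCountableTopology α] : ∃ e : α → ℝ, StrictMono e := by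
  classical
  let B := TopologicalSpace.countableBasis α
  let _ : Encodable B := (TopologicalSpace.countable_countableBasis α).toEncodable
  let w (q : α) (s : B) : ℝ := if (s : Set α) ⊆ Iio q then (1 / 2) ^ Encodable.encode s else 0
  have w_le (q : α) (s : B) : w q s ≤ (1 / 2) ^ Encodable.encode s := by
    unfold w
    split_ifs
    · exact le_rfl
    · positivity
  have w_nonneg (q : α) (s : B) : 0 ≤ w q s := by
    unfold w
    split_ifs
    · positivity
    · exact le_rfl
  have w_summable (q : α) : Summable (w q) :=
    .of_nonneg_of_le (w_nonneg q) (w_le q) summable_geometric_two_encode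
  refine ⟨fun q ↦ ∑' s, w q s, fun a b hab ↦ ?_⟩
  obtain ⟨s, hs, has, hsb⟩ := (TopologicalSpace.isBasis_countableBasis α).exists_subset_of_mem_open
    (show a ∈ Iio b from hab) isOpen_Iio
  refine Summable.tsum_lt_tsum (i := ⟨s, hs⟩) (fun t ↦ ?_) ?_ (w_summable a) (w_summable b)
  · by_cases ht : (t : Set α) ⊆ Iio a
    · have ht' : (t : Set α) ⊆ Iio b := ht.trans (Iio_subset_Iio hab.le)
      simp [w, ht, ht']
    · simpa [w, ht] using w_nonneg b t
  · have hsa : ¬ s ⊆ Iio a := fun h ↦ lt_irrefl a (h has)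
    simp [w, hsa, hsb]

open Set in
/-- A suborder of the real line has a countable subset meeting every half-open interval. -/
lemma exists_countable_meets_Ioc_Ico {α : Type*} [LinearOrder α] {e : α → ℝ} (he : StrictMono e) :
    ∃ C : Set α, C.Countable ∧
      ∀ a b, a < b → (C ∩ Ioc a b).Nonempty ∧ (C ∩ Ico a b).Nonempty := by
  classical
  let R (p : ℚ × ℚ) : Set α := {q | (p.1 : ℝ) < e q ∧ e q < p.2}
  let D : Set α := ⋃ p : ℚ × ℚ, {q | ∃ h : (R p).Nonempty, q = h.some}
  let L : Set α := ⋃ p : ℚ, {q | IsLeast {x | (p : ℝ) < e x} q}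
  let G : Set α := ⋃ p : ℚ, {q | IsGreatest {x | e x < (p : ℝ)} q}
  have hD : D.Countable := countable_iUnion fun p ↦
    Subsingleton.countable fun _ ⟨_, hx⟩ _ ⟨_, hy⟩ ↦ hx.trans hy.symm
  have hL : L.Countable := countable_iUnion fun p ↦
    Subsingleton.countable fun _ hx _ hy ↦ hx.unique hy
  have hG : G.Countable := countable_iUnion fun p ↦
    Subsingleton.countable fun _ hx _ hy ↦ hx.unique hy
  refine ⟨D ∪ L ∪ G, (hD.union hL).union hG, fun a b hab ↦ ?_⟩
  by_cases hgap : ∃ c, a < c ∧ c < b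
  · obtain ⟨c, hac, hcb⟩ := hgap
    obtain ⟨p, hap, hpc⟩ := exists_rat_btwn (he hac)
    obtain ⟨r, hcr, hrb⟩ := exists_rat_btwn (he hcb)
    have hne : (R (p, r)).Nonempty := ⟨c, hpc, hcr⟩
    have hmem : hne.some ∈ D ∪ L ∪ G := .inl (.inl (mem_iUnion.2 ⟨(p, r), hne, rfl⟩))
    have ha : a < hne.some := he.lt_iff_lt.1 (hap.trans hne.some_mem.1)
    have hb : hne.some < b := he.lt_iff_lt.1 (hne.some_mem.2.trans hrb)
    exact ⟨⟨_, hmem, ha, hb.le⟩, ⟨_, hmem, ha.le, hb⟩⟩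
  · push Not at hgap
    obtain ⟨p, hap, hpb⟩ := exists_rat_btwn (he hab)
    have hbL : b ∈ L := mem_iUnion.2 ⟨p, hpb, fun x hx ↦
      hgap x (he.lt_iff_lt.1 (hap.trans hx))⟩
    have haG : a ∈ G := mem_iUnion.2 ⟨p, hap, fun x hx ↦
      not_lt.1 fun hax ↦ (hgap x hax).not_gt (he.lt_iff_lt.1 (lt_trans hx hpb))⟩
    exact ⟨⟨b, .inl (.inr hbL), hab, le_rfl⟩, ⟨a, .inr haG, le_rfl, hab⟩⟩

open Set in
/-- The order topology of a suborder of the real line is second countable. -/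
lemma secondCountableTopology_of_strictMono_real {α : Type*} [LinearOrder α] [TopologicalSpace α]
    [OrderTopology α] {e : α → ℝ} (he : StrictMono e) : SecondCountableTopology α := by
  obtain ⟨C, hC, hmeets⟩ := exists_countable_meets_Ioc_Ico he
  refine ⟨Iio '' C ∪ Ioi '' C, (hC.image _).union (hC.image _), le_antisymm ?_ ?_⟩
  · refine le_generateFrom ?_
    rintro _ (⟨c, -, rfl⟩ | ⟨c, -, rfl⟩)
    exacts [isOpen_Iio, isOpen_Ioi]
  · rw [OrderTopology.topology_eq_generate_intervals (α := α)]
    refine le_generateFrom ?_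
    rintro _ ⟨a, rfl | rfl⟩
    · have hU : Ioi a = ⋃ c ∈ C ∩ Ici a, Ioi c := by
        ext x
        simp only [mem_Ioi, mem_iUnion, exists_prop]
        refine ⟨fun hx ↦ ?_, fun ⟨c, hc, hx⟩ ↦ lt_of_le_of_lt hc.2 hx⟩
        obtain ⟨c, hc, hac, hcx⟩ := (hmeets a x hx).2
        exact ⟨c, ⟨hc, hac⟩, hcx⟩
      rw [hU]
      exact @isOpen_biUnion _ _ (_) _ _ fun c hc ↦ .basic _ (.inr ⟨c, hc.1, rfl⟩)
    · have hU : Iio a = ⋃ c ∈ C ∩ Iic a, Iio c := by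
        ext x
        simp only [mem_Iio, mem_iUnion, exists_prop]
        refine ⟨fun hx ↦ ?_, fun ⟨c, hc, hx⟩ ↦ lt_of_lt_of_le hx hc.2⟩
        obtain ⟨c, hc, hxc, hca⟩ := (hmeets x a hx).1
        exact ⟨c, ⟨hc, hca⟩, hxc⟩
      rw [hU]
      exact @isOpen_biUnion _ _ (_) _ _ fun c hc ↦ .basic _ (.inl ⟨c, hc.1, rfl⟩)

/-- A linear order embeds into the real line if and only if its order topology is second
countable. -/
lemma secondCountableTopology_iff_exists_strictMono_real (α : Type*) [LinearOrder α]
    [TopologicalSpace α] [OrderTopology α] :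
    SecondCountableTopology α ↔ ∃ e : α → ℝ, StrictMono e :=
  ⟨fun _ ↦ exists_strictMono_real α, fun ⟨_, he⟩ ↦ secondCountableTopology_of_strictMono_real he⟩

/-- For a symmetric function with values in a linear order, the isosceles condition on triples is
the strong triangle inequality. -/
lemma permTriple_iff_le_max {X Q : Type*} [LinearOrder Q] {d : X → X → Q}
    (hsymm : ∀ x y, d x y = d y x) (x y z : X) :
    PermTriple (fun a b c ↦ d a c ≤ d a b ∧ d a b = d b c) x y z ↔
      d x y ≤ max (d x z) (d z y) ∧ d x z ≤ max (d x y) (d y z) ∧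
        d y z ≤ max (d y x) (d x z) := by
  have hxy := hsymm x y
  have hxz := hsymm x z
  have hyz := hsymm y z
  constructor
  · rintro ⟨σ, hσ⟩
    have h01 : σ 0 ≠ σ 1 := σ.injective.ne (by decide)
    have h02 : σ 0 ≠ σ 2 := σ.injective.ne (by decide)
    have h12 : σ 1 ≠ σ 2 := σ.injective.ne (by decide)
    generalize σ 0 = i at *
    generalize σ 1 = j at *
    generalize σ 2 = k at *
    fin_cases i <;> fin_cases j <;> fin_cases k <;> simp at h01 h02 h12 hσ <;> grind
  · rintro ⟨h₁, h₂, h₃⟩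
    have hcases : (d x z ≤ d x y ∧ d x y = d y z) ∨ (d x y ≤ d x z ∧ d x z = d z y) ∨
        (d y z ≤ d y x ∧ d y x = d x z) := by grind
    rcases hcases with h | h | h
    · exact ⟨1, h⟩
    · exact ⟨Equiv.swap 1 2, h⟩
    · exact ⟨Equiv.swap 0 1, h⟩

/-- A strictly monotone real function vanishing at the smallest element turns a pseudoultrametric
with values in a linear order into a real-valued one. -/
lemma QPseudoUltra.isPseudoUltrametric_comp {X Q : Type*} [LinearOrder Q] {q₀ : Q}
    (hq₀ : ∀ q, q₀ ≤ q) {d : X → X → Q} (hd : QPseudoUltra (· ≤ ·) q₀ d) {e : Q → ℝ}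
    (he : Monotone e) (he₀ : e q₀ = 0) : IsPseudoUltrametric fun x y ↦ e (d x y) := by
  obtain ⟨hsymm, hdiag, htriple⟩ := hd
  refine ⟨fun x y ↦ he₀ ▸ he (hq₀ _), fun x y ↦ congrArg e (hsymm x y), fun x ↦ ?_,
    fun x y z ↦ ?_⟩
  · simp only [hdiag, he₀]
  · rw [← he.map_max]
    exact he ((permTriple_iff_le_max hsymm x y z).1 (htriple x y z)).1

/-- The ultrametric on a linear order with smallest element `q₀` whose value at two distinct points
is their maximum. -/
def maxUltra {Q : Type*} [LinearOrder Q] (q₀ x y : Q) : Q := if x = y then q₀ else max x y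

lemma maxUltra_of_lt {Q : Type*} [LinearOrder Q] {q₀ x y : Q} (h : x < y) :
    maxUltra q₀ x y = y := by
  rw [maxUltra, if_neg h.ne, max_eq_right h.le]

lemma maxUltra_bot_left {Q : Type*} [LinearOrder Q] {q₀ : Q} (hq₀ : ∀ q, q₀ ≤ q) (q : Q) :
    maxUltra q₀ q₀ q = q := by
  unfold maxUltra
  split_ifs with h
  · exact h
  · exact max_eq_right (hq₀ q)

lemma qPseudoUltra_maxUltra {Q : Type*} [LinearOrder Q] {q₀ : Q} (hq₀ : ∀ q, q₀ ≤ q) :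
    QPseudoUltra (· ≤ ·) q₀ (maxUltra q₀) := by
  have hsymm (x y : Q) : maxUltra q₀ x y = maxUltra q₀ y x := by grind [maxUltra]
  have htri (x y z : Q) : maxUltra q₀ x y ≤ max (maxUltra q₀ x z) (maxUltra q₀ z y) := by
    have hx := hq₀ x
    have hy := hq₀ y
    grind [maxUltra]
  exact ⟨hsymm, fun x ↦ if_pos rfl, fun x y z ↦
    (permTriple_iff_le_max hsymm x y z).2 ⟨htri x y z, htri x z y, htri y z x⟩⟩

/-- If the ultrametric `maxUltra` is combinatorially similar to a real-valued pseudoultrametric,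
then the underlying order embeds into the real line. -/
lemma exists_strictMono_of_combSim_maxUltra {Q Y : Type*} [LinearOrder Q] {q₀ : Q}
    (hq₀ : ∀ q, q₀ ≤ q) {ρ : Y → Y → ℝ} (hρ : IsPseudoUltrametric ρ)
    (h : CombSim (maxUltra q₀) ρ) : ∃ e : Q → ℝ, StrictMono e := by
  obtain ⟨g, ⟨-, hg⟩, f, ⟨-, hinj, -⟩, hf⟩ := h
  obtain ⟨-, hsymm, -, htri⟩ := hρ
  have hrng (q : Q) : q ∈ rng (maxUltra q₀) := ⟨q₀, q, maxUltra_bot_left hq₀ q⟩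
  refine ⟨f, Monotone.strictMono_of_injective (fun a b hab ↦ ?_)
    fun a b ↦ hinj (hrng a) (hrng b)⟩
  rcases hab.eq_or_lt with rfl | hab
  · exact le_rfl
  obtain ⟨x, hx⟩ := hg q₀
  obtain ⟨y, rfl⟩ := hg a
  obtain ⟨z, rfl⟩ := hg b
  have hxy : ρ x y = f (g y) := by rw [hf, hx, maxUltra_bot_left hq₀]
  have hxz : ρ x z = f (g z) := by rw [hf, hx, maxUltra_bot_left hq₀]
  have hyz : ρ z y = f (g z) := by rw [hsymm, hf, maxUltra_of_lt hab]
  simpa [hxy, hxz, hyz] using htri x y z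

/-- Weakly similar mappings are combinatorially similar. -/
lemma WeakSim.combSim {X Y P Q : Type*} [Nonempty P] {le₁ : Q → Q → Prop} {le₂ : P → P → Prop}
    {d : X → X → Q} {ρ : Y → Y → P} {g : X → Y} (h : WeakSim le₁ le₂ d ρ g) : CombSim d ρ := by
  obtain ⟨hg, f, hf, -, hdf⟩ := h
  let g' := (Equiv.ofBijective g hg).symm
  refine ⟨g', g'.bijective, Function.invFunOn f (rng ρ), ?_, fun x y ↦ ?_⟩
  · exact (Set.InvOn.symm hf.invOn_invFunOn).bijOn hf.surjOn.mapsTo_invFunOn hf.mapsTo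
  · have hgg (y : Y) : g (g' y) = y := Equiv.ofBijective_apply_symm_apply g hg y
    rw [hdf, hgg, hgg]
    exact (hf.invOn_invFunOn.1 ⟨x, y, rfl⟩).symm

/-- Relabelling the values of a mapping along a strictly monotone function is a weak similarity. -/
lemma weakSim_comp {X P Q : Type*} [Nonempty Q] [LinearOrder Q] [Preorder P] (d : X → X → Q)
    {e : Q → P} (he : StrictMono e) :
    WeakSim (· ≤ ·) (· ≤ ·) d (fun x y ↦ e (d x y)) id := by
  have hleft : Function.LeftInverse (Function.invFun e) e := Function.leftInverse_invFun he.injective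
  refine ⟨Function.bijective_id, Function.invFun e, ⟨?_, ?_, ?_⟩, ?_, fun x y ↦ ?_⟩
  · rintro _ ⟨x, y, rfl⟩
    exact ⟨x, y, (hleft _).symm⟩
  · rintro _ ⟨x, y, rfl⟩ _ ⟨x', y', rfl⟩ h
    simpa only [hleft _] using congrArg e h
  · rintro _ ⟨x, y, rfl⟩
    exact ⟨e (d x y), ⟨x, y, rfl⟩, hleft _⟩
  · rintro _ ⟨x, y, rfl⟩ _ ⟨x', y', rfl⟩
    simp only [hleft _, he.le_iff_le]
  · exact (hleft _).symm

universe u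

/-- Theorem 4.15: for a totally ordered set `(Q, ≼_Q)` with `|Q| > 1` and smallest element
`q₀`, the following are equivalent: (i) the order topology on `Q` is second countable;
(ii) every `≼_Q`-pseudoultrametric is weakly similar to a real-valued pseudoultrametric;
(iii) every `≼_Q`-pseudoultrametric is combinatorially similar to a real-valued
pseudoultrametric. -/
theorem statement17 {Q : Type u} (leQ : Q → Q → Prop) (q₀ : Q)
    (hlin : IsLinearOrder Q leQ) (hq₀ : ∀ q, leQ q₀ q) (hQ : ∃ a b : Q, a ≠ b) :
    List.TFAE [
      @SecondCountableTopology Q (TopologicalSpace.generateFrom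
        ({S : Set Q | ∃ a, S = {q | leQ q a ∧ q ≠ a}} ∪
          {S : Set Q | ∃ a, S = {q | leQ a q ∧ a ≠ q}})),
      ∀ (X : Type u) (_ : Nonempty X) (d : X → X → Q), QPseudoUltra leQ q₀ d →
        ∃ (Y : Type u) (ρ : Y → Y → ℝ) (g : X → Y),
          IsPseudoUltrametric ρ ∧ WeakSim leQ (fun a b : ℝ => a ≤ b) d ρ g,
      ∀ (X : Type u) (_ : Nonempty X) (d : X → X → Q), QPseudoUltra leQ q₀ d →
        ∃ (Y : Type u) (ρ : Y → Y → ℝ), IsPseudoUltrametric ρ ∧ CombSim d ρ ] := by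
  classical
  let _ : LinearOrder Q :=
    { le := leQ
      le_refl := hlin.refl
      le_trans := hlin.trans
      le_antisymm := hlin.antisymm
      le_total := hlin.total
      toDecidableLE := Classical.decRel _ }
  change ∀ q, q₀ ≤ q at hq₀
  have htop : TopologicalSpace.generateFrom
      ({S : Set Q | ∃ a, S = {q | leQ q a ∧ q ≠ a}} ∪
        {S : Set Q | ∃ a, S = {q | leQ a q ∧ a ≠ q}}) = Preorder.topology Q := by
    have hIio (a : Q) : {q | leQ q a ∧ q ≠ a} = Set.Iio a :=
      Set.ext fun q ↦ (lt_iff_le_and_ne (a := q) (b := a)).symm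
    have hIoi (a : Q) : {q | leQ a q ∧ a ≠ q} = Set.Ioi a :=
      Set.ext fun q ↦ (lt_iff_le_and_ne (a := a) (b := q)).symm
    unfold Preorder.topology
    congr 1
    ext S
    simp only [hIio, hIoi, Set.mem_union, Set.mem_ofPred_eq, exists_or]
    exact or_comm
  rw [htop]
  let _ : TopologicalSpace Q := Preorder.topology Q
  have _ : OrderTopology Q := ⟨rfl⟩
  have _ : Nonempty Q := ⟨q₀⟩
  rw [secondCountableTopology_iff_exists_strictMono_real Q]
  tfae_have 1 → 2 := by
    rintro ⟨e, he⟩ X _ d hd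
    have he' : StrictMono fun q ↦ e q - e q₀ := fun a b hab ↦ sub_lt_sub_right (he hab) _
    exact ⟨X, _, id, hd.isPseudoUltrametric_comp hq₀ he'.monotone (sub_self _),
      weakSim_comp d he'⟩
  tfae_have 2 → 3 := by
    intro h X hX d hd
    obtain ⟨Y, ρ, g, hρ, hg⟩ := h X hX d hd
    exact ⟨Y, ρ, hρ, hg.combSim⟩
  tfae_have 3 → 1 := by
    intro h
    obtain ⟨Y, ρ, hρ, hsim⟩ := h Q ⟨q₀⟩ (maxUltra q₀) (qPseudoUltra_maxUltra hq₀)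
    exact exists_strictMono_of_combSim_maxUltra hq₀ hρ hsim
  tfae_finish

end CombSimPaper
end

section
/- Let X be a nonempty set and let Φ be a mapping with domain X². Then the following three conditions are equivalent: (i) Φ is combinatorially similar to a pseudoultrametric; (ii) there is b₀ ∈ Φ(X²) such that Φ(x,x) = b₀ for every x ∈ X, the binary relation ≼_Φ := u_Φᵗ ∪ Δ_{Φ(X²)} is a partial order on Φ(X²), b₀ is the smallest element of (Φ(X²),≼_Φ), Φ is a ≼_Φ-pseudoultrametric on X, and there is a linear order ≼ on Φ(X²) such that ≼_Φ ⊆ ≼ and (Φ(X²),≼) is order-isomorphic to a subposet of (ℝ⁺,≤); (iii) Φ is symmetric, Φ is a₀-coherent for some a₀ ∈ Φ(X²), for every triple ⟨x₁,x₂,x₃⟩ of points of X there is a permutation ⟨x_{i₁},x_{i₂},x_{i₃}⟩ of it such that Φ(x_{i₁},x_{i₂}) = Φ(x_{i₂},x_{i₃}), and there is a linear order ≼ on Φ(X²) such that a₀ is the smallest element of (Φ(X²),≼), u_Φ ⊆ ≼ holds, and (Φ(X²),≼) is order-isomorphic to a subposet of (ℝ⁺,≤). -/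
namespace CombSimPaper

universe u v

/-- A triple has a permutation satisfying `P` iff one of its six arrangements does. -/
theorem permTriple_iff {X : Type*} {P : X → X → X → Prop} {x y z : X} :
    PermTriple P x y z ↔
      P x y z ∨ P x z y ∨ P y x z ∨ P y z x ∨ P z x y ∨ P z y x := by
  constructor
  · rintro ⟨σ, h⟩
    have h01 : σ 0 ≠ σ 1 := σ.injective.ne (by decide)
    have h02 : σ 0 ≠ σ 2 := σ.injective.ne (by decide)
    have h12 : σ 1 ≠ σ 2 := σ.injective.ne (by decide)
    generalize σ 0 = i at *
    generalize σ 1 = j at *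
    generalize σ 2 = k at *
    fin_cases i <;> fin_cases j <;> fin_cases k <;> simp_all
  · rintro (h | h | h | h | h | h)
    · exact ⟨1, h⟩
    · exact ⟨Equiv.swap 1 2, h⟩
    · exact ⟨Equiv.swap 0 1, h⟩
    · exact ⟨finRotate 3, h⟩
    · exact ⟨(finRotate 3)⁻¹, h⟩
    · exact ⟨Equiv.swap 0 2, h⟩

theorem mem_rng {X A : Type*} (Φ : X → X → A) (x y : X) : Φ x y ∈ rng Φ := ⟨x, y, rfl⟩

/-- Relabelling the values of `Φ` injectively by real numbers turns `Φ` into a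
pseudoultrametric. -/
def IsRelabelling {X A : Type*} (Φ : X → X → A) (e : A → ℝ) : Prop :=
  Set.InjOn e (rng Φ) ∧ IsPseudoUltrametric fun x y => e (Φ x y)

theorem exists_combSim_iff {X : Type u} {A : Type v} [Nonempty X] {Φ : X → X → A} :
    (∃ (Y : Type u) (_ : Nonempty Y) (ρ : Y → Y → ℝ), IsPseudoUltrametric ρ ∧ CombSim Φ ρ) ↔
      ∃ e, IsRelabelling Φ e := by
  constructor
  · rintro ⟨Y, -, ρ, ⟨h0, hs, hd, ht⟩, g, hg, f, hf, hρ⟩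
    refine ⟨f, hf.injOn, ?_, ?_, ?_, ?_⟩
    · exact hg.2.forall₂.2 fun x y => by simpa [← hρ] using h0 x y
    · exact hg.2.forall₂.2 fun x y => by simpa [← hρ] using hs x y
    · exact hg.2.forall.2 fun x => by simpa [← hρ] using hd x
    · exact hg.2.forall₃.2 fun x y z => by simpa only [← hρ] using ht x y z
  · rintro ⟨e, he, hu⟩
    refine ⟨X, inferInstance, fun x y => e (Φ x y), hu, id, Function.bijective_id, e,
      ⟨?_, he, ?_⟩, fun _ _ => rfl⟩
    · rintro _ ⟨x, y, rfl⟩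
      exact ⟨x, y, rfl⟩
    · rintro _ ⟨x, y, rfl⟩
      exact ⟨_, mem_rng Φ x y, rfl⟩

/-- An isosceles symmetric mapping with constant diagonal admits a relabelling as soon as
`uRel Φ` is contained in a relation on its range that embeds in `ℝ⁺` and has the diagonal
value as smallest element. -/
theorem exists_isRelabelling {X A : Type*} {Φ : X → X → A} {a₀ : A} {r : A → A → Prop}
    (hs : ∀ x y, Φ x y = Φ y x) (hd : ∀ x, Φ x x = a₀) (ha₀ : a₀ ∈ rng Φ)
    (hmin : ∀ b ∈ rng Φ, r a₀ b) (hu : ∀ a b, uRel Φ a b → r a b)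
    (hr : EmbedsInRPlus (rng Φ) r)
    (hiso : ∀ x₁ x₂ x₃, PermTriple (fun a b c => Φ a b = Φ b c) x₁ x₂ x₃) :
    ∃ e, IsRelabelling Φ e := by
  obtain ⟨e, -, hinj, hle⟩ := hr
  refine ⟨fun a => e a - e a₀, fun a ha b hb hab => hinj ha hb (sub_left_injective hab),
    fun x y => ?_, fun x y => ?_, fun x => ?_, fun x y z => ?_⟩
  · exact sub_nonneg.2 ((hle _ ha₀ _ (mem_rng Φ x y)).1 (hmin _ (mem_rng Φ x y)))
  · simp only [hs x y]
  · simp [hd]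
  · have key : ∀ a b c, Φ a b = Φ b c → e (Φ a c) ≤ e (Φ a b) := fun a b c h =>
      (hle _ (mem_rng Φ a c) _ (mem_rng Φ a b)).1 (hu _ _ ⟨a, b, c, rfl, rfl, h⟩)
    have := hs x y
    have := hs x z
    have := hs y z
    rw [max_sub_sub_right, sub_le_sub_iff_right, le_max_iff]
    rcases permTriple_iff.1 (hiso x y z) with h | h | h | h | h | h <;>
      have := key _ _ _ h <;> grind

namespace IsRelabelling

variable {X A : Type*} {Φ : X → X → A} {e : A → ℝ}

theorem apply_eq (he : IsRelabelling Φ e) {x y z w : X} (h : e (Φ x y) = e (Φ z w)) :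
    Φ x y = Φ z w :=
  he.1 (mem_rng Φ x y) (mem_rng Φ z w) h

theorem symm (he : IsRelabelling Φ e) (x y : X) : Φ x y = Φ y x :=
  he.apply_eq (he.2.2.1 x y)

theorem diag_eq (he : IsRelabelling Φ e) (x y : X) : Φ x x = Φ y y :=
  he.apply_eq ((he.2.2.2.1 x).trans (he.2.2.2.1 y).symm)

theorem eq_zero_iff (he : IsRelabelling Φ e) {x y z : X} : e (Φ x y) = 0 ↔ Φ x y = Φ z z :=
  ⟨fun h => he.apply_eq (h.trans (he.2.2.2.1 z).symm), fun h => h ▸ he.2.2.2.1 z⟩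

theorem le_of_uRel (he : IsRelabelling Φ e) {a b : A} (h : uRel Φ a b) : e a ≤ e b := by
  obtain ⟨x, y, z, rfl, rfl, h⟩ := h
  simpa [← h] using he.2.2.2.2 x z y

theorem le_of_lePhi (he : IsRelabelling Φ e) {a b : A} (h : lePhi Φ a b) : e a ≤ e b := by
  rcases h with h | ⟨rfl, -⟩
  · induction h with
    | single h => exact he.le_of_uRel h
    | tail _ h ih => exact ih.trans (he.le_of_uRel h)
  · exact le_rfl

theorem isLinearOrderOn (he : IsRelabelling Φ e) :
    IsLinearOrderOn (rng Φ) fun a b => e a ≤ e b :=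
  ⟨⟨fun _ _ => le_rfl, fun _ _ _ _ _ _ => le_trans,
    fun _ _ ha hb hab hba => he.1 ha hb (le_antisymm hab hba)⟩,
    fun a b _ _ => le_total (e a) (e b)⟩

theorem embedsInRPlus (he : IsRelabelling Φ e) :
    EmbedsInRPlus (rng Φ) fun a b => e a ≤ e b := by
  refine ⟨e, ?_, he.1, fun _ _ _ _ => Iff.rfl⟩
  rintro _ ⟨x, y, rfl⟩
  exact he.2.1 x y

theorem permTriple (he : IsRelabelling Φ e) (x y z : X) :
    PermTriple (fun a b c => Φ a b = Φ b c) x y z := by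
  rw [permTriple_iff]
  have hxy := he.symm x y
  have hxz := he.symm x z
  have hyz := he.symm y z
  have h₁ := he.2.2.2.2 x y z
  have h₂ := he.2.2.2.2 x z y
  have h₃ := he.2.2.2.2 y z x
  simp only [← hxy, ← hxz, ← hyz] at h₁ h₂ h₃ ⊢
  have : e (Φ x y) = e (Φ x z) ∨ e (Φ x y) = e (Φ y z) ∨ e (Φ x z) = e (Φ y z) := by
    rw [le_max_iff] at h₁ h₂ h₃
    by_contra! hne
    rcases hne.1.lt_or_gt with h | h <;> rcases hne.2.1.lt_or_gt with h' | h' <;>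
      rcases hne.2.2.lt_or_gt with h'' | h'' <;> grind
  rcases this with h | h | h <;> simp [he.apply_eq h]

theorem isPartialOrderOn_lePhi (he : IsRelabelling Φ e) :
    IsPartialOrderOn (rng Φ) (lePhi Φ) := by
  refine ⟨fun a ha => Or.inr ⟨rfl, ha⟩, ?_, fun a b ha hb hab hba =>
    he.1 ha hb (le_antisymm (he.le_of_lePhi hab) (he.le_of_lePhi hba))⟩
  rintro a b c - - - (hab | ⟨rfl, -⟩) hbc
  · rcases hbc with hbc | ⟨rfl, -⟩
    · exact Or.inl (hab.trans hbc)
    · exact Or.inl hab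
  · exact hbc

theorem coherent_diag (he : IsRelabelling Φ e) (x : X) : Coherent Φ (Φ x x) := by
  have h0 := he.2.1
  have hs := he.2.2.1
  have ht := he.2.2.2.2
  refine ⟨⟨fun y => he.diag_eq y x, fun {y z} h => (he.symm z y).trans h,
    fun {a b c} hab hbc => ?_⟩, fun a b c d hab hcd => he.apply_eq ?_⟩
  · rw [fiber, ← he.eq_zero_iff] at *
    have := ht a c b
    have := h0 a c
    grind
  · rw [fiber, ← he.eq_zero_iff] at *
    have := ht a c b
    have := ht b c d
    have := ht b d a
    have := ht a d c
    have := hs a b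
    have := hs c d
    have := h0 a c
    have := h0 b d
    grind

end IsRelabelling

/-- Theorem 4.20: for a mapping `Φ` with domain `X²`, the following are equivalent:
(i) `Φ` is combinatorially similar to a pseudoultrametric; (ii) `Φ(x,x) = b₀` is constant,
`≼_Φ := u_Φᵗ ∪ Δ_{Φ(X²)}` is a partial order on `Φ(X²)` with smallest element `b₀`, `Φ` is a
`≼_Φ`-pseudoultrametric, and there is a linear order `≼` on `Φ(X²)` containing `≼_Φ` such
that `(Φ(X²), ≼)` is order-isomorphic to a subposet of `(ℝ⁺, ≤)`; (iii) `Φ` is symmetric,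
`a₀`-coherent for some `a₀` in its range, every triple admits an isosceles permutation, and
there is a linear order `≼` on `Φ(X²)` with smallest element `a₀`, containing `u_Φ`, such
that `(Φ(X²), ≼)` is order-isomorphic to a subposet of `(ℝ⁺, ≤)`. -/
theorem statement18 {X : Type u} {A : Type v} [Nonempty X] (Φ : X → X → A) :
    List.TFAE [
      ∃ (Y : Type u) (_ : Nonempty Y) (ρ : Y → Y → ℝ), IsPseudoUltrametric ρ ∧ CombSim Φ ρ,
      ∃ b₀ ∈ rng Φ, (∀ x, Φ x x = b₀) ∧
        IsPartialOrderOn (rng Φ) (lePhi Φ) ∧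
        (∀ b ∈ rng Φ, lePhi Φ b₀ b) ∧
        QPseudoUltra (lePhi Φ) b₀ Φ ∧
        ∃ r : A → A → Prop, IsLinearOrderOn (rng Φ) r ∧
          (∀ a b, lePhi Φ a b → r a b) ∧ EmbedsInRPlus (rng Φ) r,
      (∀ x y, Φ x y = Φ y x) ∧
        (∃ a₀ ∈ rng Φ, Coherent Φ a₀ ∧
          ∃ r : A → A → Prop, IsLinearOrderOn (rng Φ) r ∧
            (∀ b ∈ rng Φ, r a₀ b) ∧
            (∀ a b, uRel Φ a b → r a b) ∧ EmbedsInRPlus (rng Φ) r) ∧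
        ∀ x₁ x₂ x₃ : X, PermTriple (fun a b c => Φ a b = Φ b c) x₁ x₂ x₃ ] := by
  have one_iff := exists_combSim_iff (Φ := Φ)
  tfae_have 1 → 2 := by
    rw [one_iff]
    rintro ⟨e, he⟩
    obtain ⟨x₀⟩ := ‹Nonempty X›
    refine ⟨Φ x₀ x₀, mem_rng Φ x₀ x₀, fun x => he.diag_eq x x₀, he.isPartialOrderOn_lePhi, ?_,
      ⟨he.symm, fun x => he.diag_eq x x₀, fun x y z => ?_⟩,
      _, he.isLinearOrderOn, fun a b => he.le_of_lePhi, he.embedsInRPlus⟩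
    · rintro _ ⟨x, y, rfl⟩
      exact Or.inl (.single ⟨x, y, x, he.diag_eq x₀ x, rfl, he.symm x y⟩)
    · obtain ⟨σ, h⟩ := he.permTriple x y z
      exact ⟨σ, Or.inl (.single ⟨_, _, _, rfl, rfl, h⟩), h⟩
  tfae_have 1 → 3 := by
    rw [one_iff]
    rintro ⟨e, he⟩
    obtain ⟨x₀⟩ := ‹Nonempty X›
    refine ⟨he.symm, ⟨Φ x₀ x₀, mem_rng Φ x₀ x₀, he.coherent_diag x₀, _, he.isLinearOrderOn,
      ?_, fun a b => he.le_of_uRel, he.embedsInRPlus⟩, he.permTriple⟩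
    rintro _ ⟨x, y, rfl⟩
    exact (he.2.2.2.1 x₀).trans_le (he.2.1 x y)
  tfae_have 2 → 1 := by
    rw [one_iff]
    rintro ⟨b₀, hb₀, hd, -, hmin, ⟨hs, -, hiso⟩, r, -, hr, hemb⟩
    exact exists_isRelabelling hs hd hb₀ (fun b hb => hr _ _ (hmin b hb))
      (fun a b h => hr _ _ (Or.inl (.single h))) hemb
      fun x y z => (hiso x y z).imp fun _ h => h.2
  tfae_have 3 → 1 := by
    rw [one_iff]
    rintro ⟨hs, ⟨a₀, ha₀, hcoh, r, -, hmin, hu, hemb⟩, hiso⟩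
    exact exists_isRelabelling hs hcoh.1.refl ha₀ hmin hu hemb hiso
  tfae_finish

end CombSimPaper
end
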